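/- Let n ≥ 2, k ≥ 1, ℓ ∈ {0, …, k−1} with k − ℓ < n, and let A(D) be a homogeneous linear differential operator of order k on ℝⁿ from V to E which is injectively elliptic. If there exists a constant C ∈ (0,∞) such that for every u ∈ C^∞_c(ℝⁿ, V) one has ∫_{ℝⁿ} |D^ℓ u(x)| / |x|^{k−ℓ} dx ≤ C ∫_{ℝⁿ} |A(D)u|, then A(D) is cancelling. -/

import Mathlib

open MeasureTheory

noncomputable section

/-- First-order partial derivative in the `i`-th coordinate direction. -/
def pd {n : ℕ} {V : Type*} [NormedAddCommGroup V] [NormedSpace ℝ V] (i : Fin n)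
    (u : EuclideanSpace ℝ (Fin n) → V) : EuclideanSpace ℝ (Fin n) → V :=
  fun x => fderiv ℝ u x (EuclideanSpace.single i 1)

/-- Iterated partial derivative `∂^α`. -/
def pdMulti {n : ℕ} {V : Type*} [NormedAddCommGroup V] [NormedSpace ℝ V] (α : Fin n → ℕ)
    (u : EuclideanSpace ℝ (Fin n) → V) : EuclideanSpace ℝ (Fin n) → V :=
  (List.finRange n).foldr (fun i v => (pd i)^[α i] v) u

/-- The homogeneous differential operator `A(D) = ∑_{|α|=k} A_α ∂^α` applied to `u`. -/
def opApply {n : ℕ} {V E : Type*} [NormedAddCommGroup V] [NormedSpace ℝ V]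
    [NormedAddCommGroup E] [NormedSpace ℝ E]
    (k : ℕ) (A : (Fin n → ℕ) → (V →ₗ[ℝ] E))
    (u : EuclideanSpace ℝ (Fin n) → V) : EuclideanSpace ℝ (Fin n) → E :=
  fun x => ∑ α ∈ Finset.Nat.antidiagonalTuple n k, A α (pdMulti α u x)

/-- The symbol `A(ξ) = ∑_{|α|=k} ξ^α A_α` of the operator. -/
def symb {n : ℕ} {V E : Type*} [NormedAddCommGroup V] [NormedSpace ℝ V]
    [NormedAddCommGroup E] [NormedSpace ℝ E]
    (k : ℕ) (A : (Fin n → ℕ) → (V →ₗ[ℝ] E)) (ξ : EuclideanSpace ℝ (Fin n)) :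
    V →ₗ[ℝ] E :=
  ∑ α ∈ Finset.Nat.antidiagonalTuple n k, (∏ i, ξ i ^ α i) • A α

/-- `T` is a constant-coefficient homogeneous operator of order `m` with symbol `p`,
expressed through the iterated Fréchet derivative. -/
def IsDirOp {n : ℕ} {V : Type*} [NormedAddCommGroup V] [NormedSpace ℝ V] (m : ℕ)
    (p : EuclideanSpace ℝ (Fin n) → ℝ)
    (T : (EuclideanSpace ℝ (Fin n) → V) → (EuclideanSpace ℝ (Fin n) → V)) : Prop :=
  ∃ w : Fin m → EuclideanSpace ℝ (Fin n),
    (∀ ξ, ∏ j, inner ℝ ξ (w j) = p ξ) ∧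
    ∀ u : EuclideanSpace ℝ (Fin n) → V, ContDiff ℝ (⊤ : ℕ∞) u →
      ∀ x, T u x = iteratedFDeriv ℝ m u x w

lemma IsDirOp.pd {n : ℕ} {V : Type*} [NormedAddCommGroup V] [NormedSpace ℝ V] {m : ℕ}
    {p : EuclideanSpace ℝ (Fin n) → ℝ}
    {T : (EuclideanSpace ℝ (Fin n) → V) → (EuclideanSpace ℝ (Fin n) → V)}
    (h : IsDirOp m p T) (i : Fin n) :
    IsDirOp (m + 1) (fun ξ => ξ i * p ξ) (fun u => pd i (T u)) := by
  obtain ⟨w, hw, hT⟩ := h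
  refine ⟨Fin.cons (EuclideanSpace.single i 1) w, fun ξ => ?_, fun u hu x => ?_⟩
  · rw [Fin.prod_univ_succ]
    simp [hw, EuclideanSpace.inner_single_right]
  · have : T u = fun y => iteratedFDeriv ℝ m u y w := funext (hT u hu)
    have hd : DifferentiableAt ℝ (iteratedFDeriv ℝ m u) x :=
      (hu.differentiable_iteratedFDeriv (by exact_mod_cast WithTop.coe_lt_top _)) x
    simp only [_root_.pd, this]
    rw [iteratedFDeriv_succ_apply_left]
    have h2 := (hd.hasFDerivAt.continuousMultilinear_apply_const w).fderiv
    rw [h2]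
    simp

lemma IsDirOp.pd_iter {n : ℕ} {V : Type*} [NormedAddCommGroup V] [NormedSpace ℝ V] {m : ℕ}
    {p : EuclideanSpace ℝ (Fin n) → ℝ}
    {T : (EuclideanSpace ℝ (Fin n) → V) → (EuclideanSpace ℝ (Fin n) → V)}
    (h : IsDirOp m p T) (i : Fin n) (a : ℕ) :
    IsDirOp (a + m) (fun ξ => ξ i ^ a * p ξ) (fun u => (_root_.pd i)^[a] (T u)) := by
  induction a with
  | zero => simpa using h
  | succ a ih =>
    have := ih.pd i
    simp only [Function.iterate_succ_apply']
    convert this using 1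
    · omega
    · ext ξ; ring

lemma isDirOp_foldr {n : ℕ} {V : Type*} [NormedAddCommGroup V] [NormedSpace ℝ V]
    (α : Fin n → ℕ) (l : List (Fin n)) :
    IsDirOp (V := V) (l.map α).sum (fun ξ => (l.map (fun i => ξ i ^ α i)).prod)
      (fun u => l.foldr (fun i v => (_root_.pd i)^[α i] v) u) := by
  induction l with
  | nil => exact ⟨fun _ => 0, fun ξ => by simp, fun u hu x => (iteratedFDeriv_zero_apply _).symm⟩
  | cons i l ih => simpa using ih.pd_iter i (α i)

lemma isDirOp_pdMulti {n k : ℕ} {V : Type*} [NormedAddCommGroup V] [NormedSpace ℝ V]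
    (α : Fin n → ℕ) (hα : α ∈ Finset.Nat.antidiagonalTuple n k) :
    IsDirOp (V := V) k (fun ξ => ∏ i, ξ i ^ α i) (pdMulti α) := by
  have h := isDirOp_foldr (V := V) α (List.finRange n)
  rw [Finset.Nat.mem_antidiagonalTuple] at hα
  have e1 : ((List.finRange n).map α).sum = k := by rw [← hα, ← List.ofFn_eq_map, List.sum_ofFn]
  have e2 : ∀ ξ : EuclideanSpace ℝ (Fin n),
      ((List.finRange n).map (fun i => ξ i ^ α i)).prod = ∏ i, ξ i ^ α i := by
    intro ξ; rw [← List.ofFn_eq_map, List.prod_ofFn]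
  rw [e1] at h
  simp only [e2] at h
  exact h

/-- Representation of `opApply` through the iterated derivative. -/
lemma opApply_repr {n : ℕ} {V E : Type*} [NormedAddCommGroup V] [NormedSpace ℝ V]
    [NormedAddCommGroup E] [NormedSpace ℝ E] (k : ℕ) (A : (Fin n → ℕ) → (V →ₗ[ℝ] E)) :
    ∃ w : (Fin n → ℕ) → Fin k → EuclideanSpace ℝ (Fin n),
      (∀ α ∈ Finset.Nat.antidiagonalTuple n k, ∀ ξ : EuclideanSpace ℝ (Fin n),
        ∏ j, inner ℝ ξ (w α j) = ∏ i, ξ i ^ α i) ∧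
      ∀ u : EuclideanSpace ℝ (Fin n) → V, ContDiff ℝ (⊤ : ℕ∞) u → ∀ x,
        opApply k A u x = ∑ α ∈ Finset.Nat.antidiagonalTuple n k,
          A α (iteratedFDeriv ℝ k u x (w α)) := by
  classical
  have h : ∀ α : Fin n → ℕ, ∃ w : Fin k → EuclideanSpace ℝ (Fin n),
      α ∈ Finset.Nat.antidiagonalTuple n k →
      (∀ ξ, ∏ j, inner ℝ ξ (w j) = ∏ i, ξ i ^ α i) ∧
      ∀ u : EuclideanSpace ℝ (Fin n) → V, ContDiff ℝ (⊤ : ℕ∞) u →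
      ∀ x, pdMulti α u x = iteratedFDeriv ℝ k u x w := by
    intro α
    by_cases hα : α ∈ Finset.Nat.antidiagonalTuple n k
    · obtain ⟨w, hw⟩ := isDirOp_pdMulti (V := V) α hα
      exact ⟨w, fun _ => hw⟩
    · exact ⟨0, fun h => absurd h hα⟩
  choose w hw using h
  refine ⟨w, fun α hα => (hw α hα).1, fun u hu x => ?_⟩
  exact Finset.sum_congr rfl fun α hα => by rw [(hw α hα).2 u hu x]

lemma symb_smul {n : ℕ} {V E : Type*} [NormedAddCommGroup V] [NormedSpace ℝ V]
    [NormedAddCommGroup E] [NormedSpace ℝ E]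
    (k : ℕ) (A : (Fin n → ℕ) → (V →ₗ[ℝ] E)) (t : ℝ) (ξ : EuclideanSpace ℝ (Fin n)) :
    symb k A (t • ξ) = t ^ k • symb k A ξ := by
  unfold symb
  rw [Finset.smul_sum]
  refine Finset.sum_congr rfl fun α hα => ?_
  rw [Finset.Nat.mem_antidiagonalTuple] at hα
  rw [smul_smul, ← hα, ← Finset.prod_pow_eq_pow_sum, ← Finset.prod_mul_distrib]
  simp [mul_pow]

/-- The smooth right-inverse applied to a vector in all the ranges. -/
lemma exists_G {n k : ℕ} {V E : Type*} [NormedAddCommGroup V] [InnerProductSpace ℝ V]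
    [FiniteDimensional ℝ V]
    [NormedAddCommGroup E] [InnerProductSpace ℝ E] [FiniteDimensional ℝ E]
    (A : (Fin n → ℕ) → (V →ₗ[ℝ] E))
    (hell : ∀ ξ : EuclideanSpace ℝ (Fin n), ξ ≠ 0 → Function.Injective (symb k A ξ))
    (e : E) (he : ∀ ξ : EuclideanSpace ℝ (Fin n), ξ ≠ 0 → e ∈ LinearMap.range (symb k A ξ)) :
    ∃ G : EuclideanSpace ℝ (Fin n) → V,
      (∀ ξ, ξ ≠ 0 → ContDiffAt ℝ (⊤ : ℕ∞) G ξ) ∧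
      (∀ ξ, ξ ≠ 0 → symb k A ξ (G ξ) = e) ∧
      (∀ ξ, ξ ≠ 0 → ∀ t : ℝ, t ≠ 0 → t ^ k • G (t • ξ) = G ξ) := by
  let A' : (Fin n → ℕ) → (V →L[ℝ] E) := fun α => LinearMap.toContinuousLinearMap (A α)
  let S : EuclideanSpace ℝ (Fin n) → (V →L[ℝ] E) := fun ξ =>
    ∑ α ∈ Finset.Nat.antidiagonalTuple n k, (∏ i, ξ i ^ α i) • A' α
  let B : EuclideanSpace ℝ (Fin n) → (E →L[ℝ] V) := fun ξ =>
    ∑ α ∈ Finset.Nat.antidiagonalTuple n k, (∏ i, ξ i ^ α i) •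
      ContinuousLinearMap.adjoint (A' α)
  have hS : ∀ ξ v, S ξ v = symb k A ξ v := by
    intro ξ v
    simp [S, symb, A']
  have hBS : ∀ ξ, B ξ = ContinuousLinearMap.adjoint (S ξ) := by
    intro ξ
    simp [S, B, map_sum]
  have hSs : ContDiff ℝ (⊤ : ℕ∞) S := by
    refine ContDiff.sum fun α _ => ContDiff.fun_smul ?_ contDiff_const
    refine contDiff_prod fun i _ => ContDiff.pow ?_ _
    fun_prop
  have hBs : ContDiff ℝ (⊤ : ℕ∞) B := by
    refine ContDiff.sum fun α _ => ContDiff.fun_smul ?_ contDiff_const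
    refine contDiff_prod fun i _ => ContDiff.pow ?_ _
    fun_prop
  let G : EuclideanSpace ℝ (Fin n) → V := fun ξ =>
    (Ring.inverse (B ξ ∘L S ξ) : V →L[ℝ] V) (B ξ e)
  have hu : ∀ ξ, ξ ≠ 0 → IsUnit (B ξ ∘L S ξ : V →L[ℝ] V) := by
    intro ξ hξ
    have hinj : Function.Injective (B ξ ∘L S ξ : V →L[ℝ] V) := by
      rw [injective_iff_map_eq_zero]
      intro v hv
      have h0 : S ξ v = 0 := by
        have : inner ℝ (B ξ (S ξ v)) v = 0 := by
          have : B ξ (S ξ v) = 0 := hv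
          rw [this, inner_zero_left]
        rw [hBS, ContinuousLinearMap.adjoint_inner_left] at this
        exact inner_self_eq_zero.1 this
      rw [hS] at h0
      exact hell ξ hξ (by rw [h0, map_zero])
    have hb : Function.Bijective ((B ξ ∘L S ξ : V →L[ℝ] V) : V →ₗ[ℝ] V) :=
      ⟨hinj, LinearMap.surjective_of_injective hinj⟩
    rw [ContinuousLinearMap.isUnit_iff_bijective]
    exact hb
  have hG : ∀ ξ, ξ ≠ 0 → symb k A ξ (G ξ) = e := by
    intro ξ hξ
    obtain ⟨v, hv⟩ := he ξ hξ
    have : G ξ = v := by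
      have h1 : B ξ e = (B ξ ∘L S ξ) v := by
        rw [← hv, ← hS]; rfl
      have h2 := Ring.inverse_mul_cancel _ (hu ξ hξ)
      simp only [G]
      rw [h1]
      exact congrArg (fun T : V →L[ℝ] V => T v) h2
    rw [this, hv]
  refine ⟨G, fun ξ hξ => ?_, hG, fun ξ hξ t ht => ?_⟩
  · obtain ⟨un, hun⟩ := hu ξ hξ
    have h1 : ContDiffAt ℝ (⊤ : ℕ∞) (Ring.inverse : (V →L[ℝ] V) → (V →L[ℝ] V))
        (B ξ ∘L S ξ) := by
      rw [← hun]; exact contDiffAt_ringInverse ℝ un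
    have h2 : ContDiffAt ℝ (⊤ : ℕ∞) (fun ξ => (B ξ ∘L S ξ : V →L[ℝ] V)) ξ :=
      (hBs.clm_comp hSs).contDiffAt
    exact (ContDiffAt.comp ξ h1 h2).clm_apply (hBs.contDiffAt.clm_apply contDiffAt_const)
  · apply hell ξ hξ
    rw [hG ξ hξ, map_smul, ← hG (t • ξ) (smul_ne_zero ht hξ), symb_smul, LinearMap.smul_apply]

/-- Integrability of the Hardy weight times a decaying factor. -/
lemma weight_integrable (n a : ℕ) (ha : a < n) :
    Integrable (fun x : EuclideanSpace ℝ (Fin n) =>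
      ((1 + ‖x‖) ^ (n + 1))⁻¹ / ‖x‖ ^ a) := by
  have : Nontrivial (EuclideanSpace ℝ (Fin n)) := by
    have : Nonempty (Fin n) := ⟨⟨0, by omega⟩⟩
    infer_instance
  rw [integrable_fun_norm_addHaar volume (f := fun y : ℝ => ((1 + y) ^ (n + 1))⁻¹ / y ^ a)]
  have hI : Integrable (fun y : ℝ => (1 + ‖y‖) ^ (-(2 : ℝ))) :=
    integrable_one_add_norm (by simp)
  refine Integrable.mono' hI.integrableOn ?_ ?_
  · exact (by fun_prop : Measurable _).aestronglyMeasurable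
  · refine (ae_restrict_iff' measurableSet_Ioi).2 (Filter.Eventually.of_forall ?_)
    intro y (hy : 0 < y)
    obtain ⟨b, hb⟩ : ∃ b, n = a + 1 + b := ⟨n - (a + 1), by omega⟩
    have e1 : Module.finrank ℝ (EuclideanSpace ℝ (Fin n)) - 1 = a + b := by simp; omega
    rw [e1, smul_eq_mul, Real.norm_of_nonneg (by positivity), Real.norm_of_nonneg hy.le,
      Real.rpow_neg (by positivity)]
    have : (1 + y) ^ (2 : ℝ) = (1 + y) ^ (2 : ℕ) := by norm_cast
    rw [this, pow_add]
    have : y ^ a * y ^ b * (((1 + y) ^ (n + 1))⁻¹ / y ^ a) = y ^ b * ((1 + y) ^ (n + 1))⁻¹ := by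
      field_simp
    rw [this, ← div_eq_mul_inv, div_le_iff₀ (by positivity), hb,
      show a + 1 + b + 1 = 2 + (a + b) by ring, pow_add, ← mul_assoc,
      inv_mul_cancel₀ (by positivity), one_mul]
    calc y ^ b ≤ (1 + y) ^ b := by gcongr; linarith
      _ ≤ (1 + y) ^ (a + b) := pow_le_pow_right₀ (by linarith) (by omega)

lemma decay_integrable (n : ℕ) :
    Integrable (fun x : EuclideanSpace ℝ (Fin n) => ((1 + ‖x‖) ^ (n + 1))⁻¹) := by
  have := integrable_one_add_norm (E := EuclideanSpace ℝ (Fin n)) (μ := volume)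
    (r := ((n + 1 : ℕ) : ℝ)) (by simp)
  refine this.congr (Filter.Eventually.of_forall fun x => ?_)
  simp only
  rw [Real.rpow_neg (by positivity), Real.rpow_natCast]

open SchwartzMap in
lemma schwartz_decay {n : ℕ} {V : Type*} [NormedAddCommGroup V] [NormedSpace ℝ V]
    (u : SchwartzMap (EuclideanSpace ℝ (Fin n)) V) (r m : ℕ) :
    ∃ K : ℝ, 0 ≤ K ∧ ∀ x, ‖iteratedFDeriv ℝ m u x‖ ≤ K * ((1 + ‖x‖) ^ r)⁻¹ := by
  refine ⟨2 ^ r * (Finset.Iic (r, m)).sup (fun m => SchwartzMap.seminorm ℝ m.1 m.2) u,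
    by positivity, fun x => ?_⟩
  have := SchwartzMap.one_add_le_sup_seminorm_apply (𝕜 := ℝ) (m := (r, m)) le_rfl le_rfl u x
  rw [← div_eq_mul_inv, le_div_iff₀ (by positivity), mul_comm]
  exact this

/-- The reference bump function on `ℝⁿ`. -/
def bump0 (n : ℕ) : ContDiffBump (0 : EuclideanSpace ℝ (Fin n)) := ⟨1, 2, by norm_num, by norm_num⟩

lemma bump0_one {n : ℕ} {x : EuclideanSpace ℝ (Fin n)} (hx : ‖x‖ ≤ 1) : bump0 n x = 1 :=
  (bump0 n).one_of_mem_closedBall (by simpa [bump0] using hx)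

lemma bump0_zero {n : ℕ} {x : EuclideanSpace ℝ (Fin n)} (hx : 2 ≤ ‖x‖) : bump0 n x = 0 :=
  (bump0 n).zero_of_le_dist (by simpa [bump0] using hx)

lemma bump0_smooth (n : ℕ) : ContDiff ℝ (⊤ : ℕ∞) (bump0 n) := (bump0 n).contDiff

lemma bump0_smul_smooth (n : ℕ) (c : ℝ) :
    ContDiff ℝ (⊤ : ℕ∞) (fun x : EuclideanSpace ℝ (Fin n) => bump0 n (c • x)) :=
  (bump0_smooth n).comp (contDiff_const_smul c)

lemma bump0_smul_compact (n : ℕ) (c : ℝ) (hc : 0 < c) :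
    HasCompactSupport (fun x : EuclideanSpace ℝ (Fin n) => bump0 n (c • x)) := by
  refine HasCompactSupport.of_support_subset_isCompact
    (isCompact_closedBall (0 : EuclideanSpace ℝ (Fin n)) (2 / c)) ?_
  intro x hx
  by_contra h
  simp only [Metric.mem_closedBall, dist_zero_right, not_le] at h
  apply hx
  apply bump0_zero
  rw [norm_smul, Real.norm_of_nonneg hc.le]
  rw [div_lt_iff₀ hc] at h
  linarith

lemma cutoff_bound {n : ℕ} {V : Type*} [NormedAddCommGroup V] [NormedSpace ℝ V]
    (u : SchwartzMap (EuclideanSpace ℝ (Fin n)) V) (r m : ℕ) :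
    ∃ K : ℝ, 0 ≤ K ∧ ∀ c : ℝ, 0 < c → c ≤ 1 → ∀ x,
      ‖iteratedFDeriv ℝ m (fun y => bump0 n (c • y) • u y) x‖ ≤ K * ((1 + ‖x‖) ^ r)⁻¹ := by
  have hc1 : HasCompactSupport (bump0 n) := (bump0 n).hasCompactSupport
  choose Kb hKb0 hKb using schwartz_decay (hc1.toSchwartzMap (bump0_smooth n)) 0
  choose Ku hKu0 hKu using schwartz_decay u r
  refine ⟨∑ i ∈ Finset.range (m + 1), (m.choose i : ℝ) * Kb i * Ku (m - i),
    Finset.sum_nonneg fun i _ => mul_nonneg (mul_nonneg (by positivity) (hKb0 i)) (hKu0 _), ?_⟩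
  intro c hc hc' x
  refine (norm_iteratedFDeriv_smul_le (N := (⊤ : ℕ∞)) (bump0_smul_smooth n c) (u.smooth _) x
    (by exact_mod_cast le_top)).trans ?_
  rw [Finset.sum_mul]
  refine Finset.sum_le_sum fun i _ => ?_
  have h1 : ‖iteratedFDeriv ℝ i (fun y => bump0 n (c • y)) x‖ ≤ Kb i := by
    rw [iteratedFDeriv_comp_const_smul c ((bump0_smooth n).of_le (by exact_mod_cast le_top))]
    rw [norm_smul, norm_pow, Real.norm_of_nonneg hc.le]
    have := hKb i (c • x)
    simp only [pow_zero, inv_one, mul_one] at this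
    calc c ^ i * _ ≤ 1 * Kb i := by
          gcongr
          · exact pow_le_one₀ hc.le hc'
          · exact this
      _ = _ := one_mul _
  calc _ ≤ (m.choose i : ℝ) * Kb i * (Ku (m - i) * ((1 + ‖x‖) ^ r)⁻¹) := by
        gcongr
        · exact mul_nonneg (by positivity) (hKb0 i)
        · exact hKu _ x
    _ = _ := by ring

lemma cutoff_eventually {n : ℕ} {V : Type*} [NormedAddCommGroup V] [NormedSpace ℝ V]
    (u : EuclideanSpace ℝ (Fin n) → V) (m : ℕ) (x : EuclideanSpace ℝ (Fin n)) :
    ∀ᶠ N : ℕ in Filter.atTop,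
      iteratedFDeriv ℝ m (fun y => bump0 n (((N : ℝ) + 1)⁻¹ • y) • u y) x
        = iteratedFDeriv ℝ m u x := by
  obtain ⟨N0, hN0⟩ := exists_nat_gt ‖x‖
  filter_upwards [Filter.eventually_ge_atTop N0] with N hN
  have : (fun y => bump0 n (((N : ℝ) + 1)⁻¹ • y) • u y) =ᶠ[nhds x] u := by
    have hx : x ∈ Metric.ball (0 : EuclideanSpace ℝ (Fin n)) N0 := by simpa using hN0
    filter_upwards [Metric.isOpen_ball.mem_nhds hx] with y hy
    rw [bump0_one, one_smul]
    rw [norm_smul, Real.norm_of_nonneg (by positivity), inv_mul_le_iff₀ (by positivity)]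
    have : ‖y‖ < N0 := by simpa using hy
    have : (N0 : ℝ) ≤ N := by exact_mod_cast hN
    linarith
  exact (Filter.EventuallyEq.iteratedFDeriv ℝ this m).eq_of_nhds

lemma opApply_bound {n : ℕ} {V E : Type*} [NormedAddCommGroup V] [NormedSpace ℝ V]
    [FiniteDimensional ℝ V]
    [NormedAddCommGroup E] [NormedSpace ℝ E] (k : ℕ) (A : (Fin n → ℕ) → (V →ₗ[ℝ] E)) :
    ∃ K : ℝ, 0 ≤ K ∧ ∀ u : EuclideanSpace ℝ (Fin n) → V, ContDiff ℝ (⊤ : ℕ∞) u → ∀ x,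
      ‖opApply k A u x‖ ≤ K * ‖iteratedFDeriv ℝ k u x‖ := by
  obtain ⟨w, -, hw⟩ := opApply_repr k A
  refine ⟨∑ α ∈ Finset.Nat.antidiagonalTuple n k,
    ‖LinearMap.toContinuousLinearMap (A α)‖ * ∏ j, ‖w α j‖, by positivity, fun u hu x => ?_⟩
  rw [hw u hu x, Finset.sum_mul]
  refine (norm_sum_le _ _).trans (Finset.sum_le_sum fun α _ => ?_)
  calc _ ≤ ‖LinearMap.toContinuousLinearMap (A α)‖ * ‖iteratedFDeriv ℝ k u x (w α)‖ :=
        (LinearMap.toContinuousLinearMap (A α)).le_opNorm _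
    _ ≤ ‖LinearMap.toContinuousLinearMap (A α)‖ * (‖iteratedFDeriv ℝ k u x‖ * ∏ j, ‖w α j‖) := by
        gcongr
        exact ContinuousMultilinearMap.le_opNorm _ _
    _ = _ := by ring

lemma opApply_continuous {n : ℕ} {V E : Type*} [NormedAddCommGroup V] [NormedSpace ℝ V]
    [FiniteDimensional ℝ V]
    [NormedAddCommGroup E] [NormedSpace ℝ E] (k : ℕ) (A : (Fin n → ℕ) → (V →ₗ[ℝ] E))
    (u : EuclideanSpace ℝ (Fin n) → V) (hu : ContDiff ℝ (⊤ : ℕ∞) u) :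
    Continuous (opApply k A u) := by
  obtain ⟨w, -, hw⟩ := opApply_repr k A
  rw [funext (hw u hu)]
  refine continuous_finsetSum _ fun α _ => ?_
  have h1 : Continuous (iteratedFDeriv ℝ k u) :=
    hu.continuous_iteratedFDeriv (by exact_mod_cast le_top)
  have h2 : Continuous (fun x => iteratedFDeriv ℝ k u x (w α)) := by fun_prop
  exact (LinearMap.toContinuousLinearMap (A α)).continuous.comp h2

lemma hardy_integrable {n : ℕ} {V : Type*} [NormedAddCommGroup V] [NormedSpace ℝ V]
    (ℓ a : ℕ) (ha : a < n) (u : SchwartzMap (EuclideanSpace ℝ (Fin n)) V) :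
    Integrable (fun x => ‖iteratedFDeriv ℝ ℓ u x‖ / ‖x‖ ^ a) := by
  obtain ⟨K, hK0, hK⟩ := schwartz_decay u (n + 1) ℓ
  refine ((weight_integrable n a ha).const_mul K).mono' ?_ (Filter.Eventually.of_forall fun x => ?_)
  · have h1 : Continuous (iteratedFDeriv ℝ ℓ u) :=
      (u.smooth (⊤ : ℕ∞)).continuous_iteratedFDeriv (by exact_mod_cast le_top)
    exact (h1.norm.measurable.div (by fun_prop)).aestronglyMeasurable
  · rw [Real.norm_of_nonneg (by positivity), ← mul_div_assoc]
    gcongr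
    exact hK x

/-- The Hardy inequality extends to Schwartz functions. -/
lemma hardy_schwartz {n k ℓ : ℕ} {V E : Type*} [NormedAddCommGroup V] [NormedSpace ℝ V]
    [FiniteDimensional ℝ V]
    [NormedAddCommGroup E] [NormedSpace ℝ E] (a : ℕ) (ha : a < n)
    (A : (Fin n → ℕ) → (V →ₗ[ℝ] E)) (C : ℝ)
    (hest : ∀ u : EuclideanSpace ℝ (Fin n) → V,
      ContDiff ℝ (⊤ : ℕ∞) u → HasCompactSupport u →
      ∫ x, ‖iteratedFDeriv ℝ ℓ u x‖ / ‖x‖ ^ a ≤ C * ∫ x, ‖opApply k A u x‖)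
    (u : SchwartzMap (EuclideanSpace ℝ (Fin n)) V) :
    ∫ x, ‖iteratedFDeriv ℝ ℓ u x‖ / ‖x‖ ^ a ≤ C * ∫ x, ‖opApply k A u x‖ := by
  let v : ℕ → EuclideanSpace ℝ (Fin n) → V := fun N y => bump0 n (((N : ℝ) + 1)⁻¹ • y) • u y
  have hus : ContDiff ℝ (⊤ : ℕ∞) u := u.smooth _
  have hpos : ∀ N : ℕ, 0 < ((N : ℝ) + 1)⁻¹ := fun N => by positivity
  have hle : ∀ N : ℕ, ((N : ℝ) + 1)⁻¹ ≤ 1 := fun N => inv_le_one_of_one_le₀ (by simp)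
  have hv : ∀ N, ContDiff ℝ (⊤ : ℕ∞) (v N) := fun N => (bump0_smul_smooth n _).fun_smul hus
  have hvc : ∀ N, HasCompactSupport (v N) := fun N =>
    (bump0_smul_compact n _ (hpos N)).smul_right
  have h1 : Filter.Tendsto (fun N => ∫ x, ‖iteratedFDeriv ℝ ℓ (v N) x‖ / ‖x‖ ^ a) Filter.atTop
      (nhds (∫ x, ‖iteratedFDeriv ℝ ℓ u x‖ / ‖x‖ ^ a)) := by
    obtain ⟨K, hK0, hK⟩ := cutoff_bound u (n + 1) ℓ
    refine tendsto_integral_of_dominated_convergence _ (fun N => ?_)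
      ((weight_integrable n a ha).const_mul K) (fun N => Filter.Eventually.of_forall fun x => ?_)
      (Filter.Eventually.of_forall fun x => ?_)
    · have h1 : Continuous (iteratedFDeriv ℝ ℓ (v N)) :=
        (hv N).continuous_iteratedFDeriv (by exact_mod_cast le_top)
      exact (h1.norm.measurable.div (by fun_prop)).aestronglyMeasurable
    · rw [Real.norm_of_nonneg (by positivity), ← mul_div_assoc]
      gcongr
      exact hK _ (hpos N) (hle N) x
    · refine tendsto_const_nhds.congr' ?_
      filter_upwards [cutoff_eventually u ℓ x] with N hN
      rw [← hN]
  have h2 : Filter.Tendsto (fun N => ∫ x, ‖opApply k A (v N) x‖) Filter.atTop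
      (nhds (∫ x, ‖opApply k A u x‖)) := by
    obtain ⟨K, hK0, hK⟩ := cutoff_bound u (n + 1) k
    obtain ⟨K', hK'0, hK'⟩ := opApply_bound (V := V) k A
    obtain ⟨w, -, hw⟩ := opApply_repr k A
    refine tendsto_integral_of_dominated_convergence _ (fun N => ?_)
      (((decay_integrable n).const_mul K).const_mul K')
      (fun N => Filter.Eventually.of_forall fun x => ?_)
      (Filter.Eventually.of_forall fun x => ?_)
    · exact (opApply_continuous k A _ (hv N)).norm.aestronglyMeasurable
    · rw [norm_norm]
      refine (hK' _ (hv N) x).trans ?_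
      gcongr
      exact hK _ (hpos N) (hle N) x
    · refine tendsto_const_nhds.congr' ?_
      filter_upwards [cutoff_eventually u k x] with N hN
      rw [hw _ (hv N), hw _ hus, hN]
  exact le_of_tendsto_of_tendsto' h1 (h2.const_mul C) fun N => hest _ (hv N) (hvc N)

open scoped FourierTransform SchwartzMap

lemma fourier_scale {n : ℕ} (f : EuclideanSpace ℝ (Fin n) → ℂ) (r : ℝ) (hr : 0 < r)
    (x : EuclideanSpace ℝ (Fin n)) :
    𝓕 (fun ξ => f (r • ξ)) x = ((r ^ n)⁻¹ : ℝ) • 𝓕 f (r⁻¹ • x) := by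
  rw [Real.fourier_eq, Real.fourier_eq]
  have h := Measure.integral_comp_smul_of_nonneg (volume : Measure (EuclideanSpace ℝ (Fin n)))
    (fun v => Real.fourierChar (-(inner ℝ v (r⁻¹ • x))) • f v) r (hR := hr.le)
  rw [finrank_euclideanSpace_fin] at h
  rw [← h]
  congr 1
  ext v
  rw [inner_smul_left, inner_smul_right]
  simp only [conj_trivial]
  rw [← mul_assoc, mul_inv_cancel₀ hr.ne', one_mul]

lemma fourier_scale_norm {n : ℕ} (f : EuclideanSpace ℝ (Fin n) → ℂ) (r : ℝ) (hr : 0 < r) :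
    ∫ x, ‖𝓕 (fun ξ => f (r • ξ)) x‖ = ∫ x, ‖𝓕 f x‖ := by
  simp_rw [fourier_scale f r hr, norm_smul]
  rw [integral_const_mul]
  have h := Measure.integral_comp_smul_of_nonneg (volume : Measure (EuclideanSpace ℝ (Fin n)))
    (fun v => ‖𝓕 f v‖) r⁻¹ (hR := (inv_pos.2 hr).le)
  rw [finrank_euclideanSpace_fin] at h
  rw [h, Real.norm_of_nonneg (by positivity), smul_eq_mul, ← mul_assoc]
  have : (r ^ n)⁻¹ * (r⁻¹ ^ n)⁻¹ = 1 := by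
    rw [inv_pow, inv_inv, inv_mul_cancel₀ (by positivity)]
  rw [this, one_mul]

/-- Smooth cutoff to an annulus. -/
def psi (n : ℕ) (R : ℝ) (ξ : EuclideanSpace ℝ (Fin n)) : ℝ := bump0 n (R⁻¹ • ξ) - bump0 n (R • ξ)

lemma psi_smooth (n : ℕ) (R : ℝ) : ContDiff ℝ (⊤ : ℕ∞) (psi n R) :=
  (bump0_smul_smooth n _).sub (bump0_smul_smooth n _)

lemma psi_compact (n : ℕ) (R : ℝ) (hR : 0 < R) : HasCompactSupport (psi n R) :=
  (bump0_smul_compact n _ (inv_pos.2 hR)).sub (bump0_smul_compact n _ hR)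

lemma psi_zero {n : ℕ} {R : ℝ} (hR : 1 ≤ R) {ξ : EuclideanSpace ℝ (Fin n)} (h : ‖ξ‖ ≤ R⁻¹) :
    psi n R ξ = 0 := by
  have hR0 : 0 < R := by linarith
  have h1 : R⁻¹ ≤ 1 := inv_le_one_of_one_le₀ hR
  rw [psi, bump0_one, bump0_one, sub_self]
  · rw [norm_smul, Real.norm_of_nonneg hR0.le]
    calc R * ‖ξ‖ ≤ R * R⁻¹ := by gcongr
      _ = 1 := mul_inv_cancel₀ hR0.ne'
  · rw [norm_smul, Real.norm_of_nonneg (by positivity)]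
    calc R⁻¹ * ‖ξ‖ ≤ 1 * 1 := by gcongr; linarith
      _ = 1 := one_mul _

lemma psi_one {n : ℕ} {R : ℝ} (hR : 1 ≤ R) {ξ : EuclideanSpace ℝ (Fin n)} (h : 2 ≤ R * ‖ξ‖)
    (h' : ‖ξ‖ ≤ R) : psi n R ξ = 1 := by
  have hR0 : 0 < R := by linarith
  rw [psi, bump0_one, bump0_zero, sub_zero]
  · rwa [norm_smul, Real.norm_of_nonneg hR0.le]
  · rwa [norm_smul, Real.norm_of_nonneg (by positivity), inv_mul_le_iff₀ hR0, mul_one]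

lemma ofReal_schwartz {n : ℕ} (f : EuclideanSpace ℝ (Fin n) → ℝ) (hf : ContDiff ℝ (⊤ : ℕ∞) f)
    (hc : HasCompactSupport f) :
    ∃ F : 𝓢(EuclideanSpace ℝ (Fin n), ℂ), ∀ x, F x = (f x : ℂ) := by
  have h1 : ContDiff ℝ (⊤ : ℕ∞) (fun x => (f x : ℂ)) := Complex.ofRealCLM.contDiff.comp hf
  have h2 : HasCompactSupport (fun x => (f x : ℂ)) :=
    hc.comp_left (g := fun t : ℝ => (t : ℂ)) (by simp)
  exact ⟨h2.toSchwartzMap h1, fun x => rfl⟩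

lemma psi_fourier (n : ℕ) :
    ∃ B : ℝ, 0 ≤ B ∧ ∀ R : ℝ, 0 < R → ∫ x, ‖𝓕 (fun ξ => (psi n R ξ : ℂ)) x‖ ≤ B := by
  have hint : ∀ c : ℝ, 0 < c → ∃ F : 𝓢(EuclideanSpace ℝ (Fin n), ℂ), ∀ x,
      F x = (bump0 n (c • x) : ℂ) := fun c hc =>
    ofReal_schwartz _ (bump0_smul_smooth n c) (bump0_smul_compact n c hc)
  let φ : EuclideanSpace ℝ (Fin n) → ℂ := fun ξ => (bump0 n ξ : ℂ)
  refine ⟨2 * ∫ x, ‖𝓕 φ x‖, by positivity, fun R hR => ?_⟩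
  obtain ⟨F1, hF1⟩ := hint R⁻¹ (inv_pos.2 hR)
  obtain ⟨F2, hF2⟩ := hint R hR
  have e1 : (F1 : EuclideanSpace ℝ (Fin n) → ℂ) = fun ξ => φ (R⁻¹ • ξ) := funext hF1
  have e2 : (F2 : EuclideanSpace ℝ (Fin n) → ℂ) = fun ξ => φ (R • ξ) := funext hF2
  have e : (fun ξ => (psi n R ξ : ℂ)) = (F1 - F2 : 𝓢(EuclideanSpace ℝ (Fin n), ℂ)) := by
    ext ξ
    simp [psi, hF1, hF2]
  have i1 := fourier_scale_norm φ R⁻¹ (inv_pos.2 hR)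
  have i2 := fourier_scale_norm φ R hR
  rw [← e1] at i1
  rw [← e2] at i2
  rw [e, ← SchwartzMap.fourier_coe]
  rw [← SchwartzMap.fourier_coe] at i1 i2
  have : 𝓕 (F1 - F2) = 𝓕 F1 - 𝓕 F2 := map_sub (FourierTransform.fourierCLE ℂ 𝓢(EuclideanSpace ℝ (Fin n), ℂ)) F1 F2
  rw [this, two_mul]
  nth_rewrite 1 [← i1]
  rw [← i2, ← integral_add (𝓕 F1).integrable.norm (𝓕 F2).integrable.norm]
  refine integral_mono (𝓕 F1 - 𝓕 F2).integrable.norm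
    ((𝓕 F1).integrable.norm.add (𝓕 F2).integrable.norm) fun x => ?_
  simpa using norm_sub_le (𝓕 F1 x) (𝓕 F2 x)

lemma iter_fourier {n : ℕ} {F : Type*} [NormedAddCommGroup F] [NormedSpace ℂ F]
    [CompleteSpace F] (f : 𝓢(EuclideanSpace ℝ (Fin n), F)) (m : ℕ)
    (x : EuclideanSpace ℝ (Fin n)) (w : Fin m → EuclideanSpace ℝ (Fin n)) :
    Integrable (fun ξ => Real.fourierChar (-(inner ℝ ξ x)) • ((-(2 * Real.pi * Complex.I)) ^ m •
        ((∏ j, inner ℝ ξ (w j) : ℝ) • f ξ))) ∧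
    iteratedFDeriv ℝ m (𝓕 (f : EuclideanSpace ℝ (Fin n) → F)) x w =
      ∫ ξ, Real.fourierChar (-(inner ℝ ξ x)) • ((-(2 * Real.pi * Complex.I)) ^ m •
        ((∏ j, inner ℝ ξ (w j) : ℝ) • f ξ)) := by
  have hi : Integrable (fun v => VectorFourier.fourierPowSMulRight (innerSL ℝ) f v m) :=
    VectorFourier.integrable_fourierPowSMulRight (innerSL ℝ) (f.integrable_pow_mul volume m)
      f.continuous.aestronglyMeasurable
  have h := Real.iteratedFDeriv_fourier (N := (⊤ : ℕ∞)) (f := f)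
    (fun m _ => f.integrable_pow_mul volume m) f.continuous.aestronglyMeasurable (n := m)
    le_top
  constructor
  · have h2 := (ContinuousMultilinearMap.apply ℝ _ F w).integrable_comp hi
    have h3 := (Real.fourierIntegral_convergent_iff (V := EuclideanSpace ℝ (Fin n)) x).2 h2
    refine h3.congr (Filter.Eventually.of_forall fun ξ => ?_)
    simp
    rfl
  · rw [h, Real.fourier_continuousMultilinearMap_apply hi, Real.fourier_eq]
    congr 1

/-- Real-linear map taking complex coordinates to (rotated) real parts. -/
def Lz {d : ℕ} {V : Type*} [NormedAddCommGroup V] [InnerProductSpace ℝ V]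
    (b : OrthonormalBasis (Fin d) ℝ V) (z : ℂ) : (Fin d → ℂ) →L[ℝ] V :=
  LinearMap.toContinuousLinearMap
    { toFun := fun w => ∑ i, (z * w i).re • b i
      map_add' := fun w w' => by
        rw [← Finset.sum_add_distrib]
        refine Finset.sum_congr rfl fun i _ => ?_
        rw [← add_smul, Pi.add_apply, mul_add, Complex.add_re]
      map_smul' := fun t w => by
        rw [RingHom.id_apply, Finset.smul_sum]
        refine Finset.sum_congr rfl fun i _ => ?_
        rw [smul_smul, Pi.smul_apply, mul_smul_comm, Complex.smul_re, smul_eq_mul] }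

lemma Lz_apply {d : ℕ} {V : Type*} [NormedAddCommGroup V] [InnerProductSpace ℝ V]
    (b : OrthonormalBasis (Fin d) ℝ V) (z : ℂ) (w : Fin d → ℂ) :
    Lz b z w = ∑ i, (z * w i).re • b i := rfl

lemma Lz_norm {d : ℕ} {V : Type*} [NormedAddCommGroup V] [InnerProductSpace ℝ V]
    (b : OrthonormalBasis (Fin d) ℝ V) (z : ℂ) (w : Fin d → ℂ) (i : Fin d) :
    |(z * w i).re| ≤ ‖Lz b z w‖ := by
  have h : inner ℝ (b i) (Lz b z w) = (z * w i).re := by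
    rw [Lz_apply, b.orthonormal.inner_right_fintype]
  rw [← h]
  refine (abs_real_inner_le_norm _ _).trans ?_
  rw [b.norm_eq_one, one_mul]

lemma Lz_real {d : ℕ} {V : Type*} [NormedAddCommGroup V] [InnerProductSpace ℝ V]
    (b : OrthonormalBasis (Fin d) ℝ V) (z c : ℂ) (g : V) :
    Lz b z (fun i => c * ((inner ℝ (b i) g : ℝ) : ℂ)) = (z * c).re • g := by
  rw [Lz_apply]
  conv_rhs => rw [← b.sum_repr' g, Finset.smul_sum]
  refine Finset.sum_congr rfl fun i _ => ?_
  rw [← mul_assoc, Complex.re_mul_ofReal, smul_smul]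

lemma psi_mul_smooth {n : ℕ} {R : ℝ} (hR : 1 ≤ R) (q : EuclideanSpace ℝ (Fin n) → ℝ)
    (hq : ∀ ξ, ξ ≠ 0 → ContDiffAt ℝ (⊤ : ℕ∞) q ξ) :
    ContDiff ℝ (⊤ : ℕ∞) (fun ξ => psi n R ξ * q ξ) := by
  rw [contDiff_iff_contDiffAt]
  intro ξ
  by_cases h : ξ = 0
  · subst h
    have : (fun ξ => psi n R ξ * q ξ) =ᶠ[nhds 0] fun _ => (0 : ℝ) := by
      have hR0 : 0 < R⁻¹ := by positivity
      filter_upwards [Metric.ball_mem_nhds (0 : EuclideanSpace ℝ (Fin n)) hR0] with ξ hξ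
      rw [psi_zero hR (by simpa using (le_of_lt (by simpa using hξ : ‖ξ‖ < R⁻¹))), zero_mul]
    exact contDiffAt_const.congr_of_eventuallyEq this
  · exact (psi_smooth n R).contDiffAt.mul (hq ξ h)

lemma psi_mul_compact {n : ℕ} {R : ℝ} (hR : 1 ≤ R) (q : EuclideanSpace ℝ (Fin n) → ℝ) :
    HasCompactSupport (fun ξ => psi n R ξ * q ξ) :=
  (psi_compact n R (by linarith)).mul_right

lemma exists_H {n d : ℕ} {V : Type*} [NormedAddCommGroup V] [InnerProductSpace ℝ V]
    (b : OrthonormalBasis (Fin d) ℝ V) (G : EuclideanSpace ℝ (Fin n) → V)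
    (hG : ∀ ξ, ξ ≠ 0 → ContDiffAt ℝ (⊤ : ℕ∞) G ξ) {R : ℝ} (hR : 1 ≤ R) :
    ∃ H : 𝓢(EuclideanSpace ℝ (Fin n), Fin d → ℂ), ∀ ξ i,
      H ξ i = ((psi n R ξ * inner ℝ (b i) (G ξ) : ℝ) : ℂ) := by
  let f : EuclideanSpace ℝ (Fin n) → Fin d → ℂ := fun ξ i =>
    ((psi n R ξ * inner ℝ (b i) (G ξ) : ℝ) : ℂ)
  have h1 : ContDiff ℝ (⊤ : ℕ∞) f := by
    refine contDiff_pi.2 fun i => Complex.ofRealCLM.contDiff.comp ?_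
    exact psi_mul_smooth hR _ fun ξ hξ => contDiffAt_const.inner ℝ (hG ξ hξ)
  have h2 : HasCompactSupport f := by
    refine (psi_compact n R (by linarith)).mono fun ξ hξ h0 => hξ ?_
    ext i
    simp only [f, h0, zero_mul, Complex.ofReal_zero, Pi.zero_apply]
  exact ⟨h2.toSchwartzMap h1, fun ξ i => rfl⟩

lemma op_formula {n k d : ℕ} {V E : Type*} [NormedAddCommGroup V] [InnerProductSpace ℝ V]
    [FiniteDimensional ℝ V]
    [NormedAddCommGroup E] [InnerProductSpace ℝ E] [FiniteDimensional ℝ E]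
    (A : (Fin n → ℕ) → (V →ₗ[ℝ] E)) (b : OrthonormalBasis (Fin d) ℝ V)
    (G : EuclideanSpace ℝ (Fin n) → V) (e : E)
    (hGe : ∀ ξ, ξ ≠ 0 → symb k A ξ (G ξ) = e) {R : ℝ} (hR : 1 ≤ R)
    (H : 𝓢(EuclideanSpace ℝ (Fin n), Fin d → ℂ))
    (hH : ∀ ξ i, H ξ i = ((psi n R ξ * inner ℝ (b i) (G ξ) : ℝ) : ℂ)) (z : ℂ)
    (x : EuclideanSpace ℝ (Fin n)) :
    opApply k A (fun x => Lz b z (𝓕 H x)) x =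
      (z * ((-(2 * Real.pi * Complex.I)) ^ k * 𝓕 (fun ξ => (psi n R ξ : ℂ)) x)).re • e := by
  obtain ⟨w, hw1, hw2⟩ := opApply_repr (V := V) k A
  have hUs : ContDiff ℝ (⊤ : ℕ∞) ⇑(𝓕 H : 𝓢(EuclideanSpace ℝ (Fin n), Fin d → ℂ)) := (𝓕 H).smooth _
  have hus : ContDiff ℝ (⊤ : ℕ∞) (fun x => Lz b z (𝓕 H x)) := (Lz b z).contDiff.comp hUs
  rw [hw2 _ hus]
  have hder : ∀ α, iteratedFDeriv ℝ k (fun x => Lz b z (𝓕 H x)) x (w α) =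
      Lz b z (iteratedFDeriv ℝ k (⇑(𝓕 H : 𝓢(EuclideanSpace ℝ (Fin n), Fin d → ℂ))) x (w α)) := by
    intro α
    have := (Lz b z).iteratedFDeriv_comp_left (f := ⇑(𝓕 H : 𝓢(EuclideanSpace ℝ (Fin n), Fin d → ℂ))) (x := x) (n := (⊤ : ℕ∞))
      hUs.contDiffAt (i := k) (by exact_mod_cast le_top)
    exact congrArg (fun T => T (w α)) this
  simp_rw [hder]
  let Φ : (Fin n → ℕ) → ((Fin d → ℂ) →L[ℝ] E) := fun α =>
    (LinearMap.toContinuousLinearMap (A α)) ∘L (Lz b z)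
  have hI := fun α => (iter_fourier H k x (w α)).1
  have h1 : ∀ α, A α (Lz b z (iteratedFDeriv ℝ k (⇑(𝓕 H : 𝓢(EuclideanSpace ℝ (Fin n), Fin d → ℂ))) x (w α))) =
      ∫ ξ, Φ α (Real.fourierChar (-(inner ℝ ξ x)) • ((-(2 * Real.pi * Complex.I)) ^ k •
        ((∏ j, inner ℝ ξ (w α j) : ℝ) • H ξ))) := by
    intro α
    rw [(Φ α).integral_comp_comm (hI α), ← (iter_fourier H k x (w α)).2]
    rfl
  simp_rw [h1]
  rw [← integral_finsetSum _ fun α _ => (Φ α).integrable_comp (hI α)]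
  let Ψ : ℂ →L[ℝ] E := LinearMap.toContinuousLinearMap
    { toFun := fun t => (z * ((-(2 * Real.pi * Complex.I)) ^ k * t)).re • e
      map_add' := fun s t => by rw [mul_add, mul_add, Complex.add_re, add_smul]
      map_smul' := fun c t => by
        rw [RingHom.id_apply, mul_smul_comm, mul_smul_comm, Complex.smul_re, smul_assoc] }
  obtain ⟨P, hP⟩ := ofReal_schwartz (psi n R) (psi_smooth n R) (psi_compact n R (by linarith))
  have hPi : Integrable (fun ξ => Real.fourierChar (-(inner ℝ ξ x)) • (psi n R ξ : ℂ)) := by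
    have := (Real.fourierIntegral_convergent_iff (V := EuclideanSpace ℝ (Fin n)) x).2
      (P.integrable (μ := volume))
    simpa only [hP] using this
  have h2 : (z * ((-(2 * Real.pi * Complex.I)) ^ k * 𝓕 (fun ξ => (psi n R ξ : ℂ)) x)).re • e =
      ∫ ξ, Ψ (Real.fourierChar (-(inner ℝ ξ x)) • (psi n R ξ : ℂ)) := by
    rw [Ψ.integral_comp_comm hPi, ← Real.fourier_eq]
    rfl
  rw [h2]
  congr 1
  ext ξ
  have h3 : ∀ α ∈ Finset.Nat.antidiagonalTuple n k,
      Φ α (Real.fourierChar (-(inner ℝ ξ x)) • ((-(2 * Real.pi * Complex.I)) ^ k •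
        ((∏ j, inner ℝ ξ (w α j) : ℝ) • H ξ))) =
      (z * ((-(2 * Real.pi * Complex.I)) ^ k *
        (Real.fourierChar (-(inner ℝ ξ x)) • (psi n R ξ : ℂ)))).re •
        (((∏ i, ξ i ^ α i : ℝ) • A α) (G ξ)) := by
    intro α hα
    rw [hw1 α hα]
    have e1 : (Real.fourierChar (-(inner ℝ ξ x)) • ((-(2 * Real.pi * Complex.I)) ^ k •
        ((∏ i, ξ i ^ α i : ℝ) • H ξ))) = (∏ i, ξ i ^ α i : ℝ) • (fun i =>
        ((-(2 * Real.pi * Complex.I)) ^ k *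
        (Real.fourierChar (-(inner ℝ ξ x)) • (psi n R ξ : ℂ))) *
          ((inner ℝ (b i) (G ξ) : ℝ) : ℂ)) := by
      ext i
      simp only [Pi.smul_apply, hH, Circle.smul_def, smul_eq_mul, Complex.real_smul]
      push_cast
      ring
    rw [e1, map_smul]
    change _ • A α (Lz b z _) = _
    rw [Lz_real, map_smul, LinearMap.smul_apply, smul_comm]
  rw [Finset.sum_congr rfl h3, ← Finset.smul_sum]
  have h4 : ∑ α ∈ Finset.Nat.antidiagonalTuple n k, ((∏ i, ξ i ^ α i : ℝ) • A α) (G ξ) =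
      symb k A ξ (G ξ) := by
    rw [symb, LinearMap.sum_apply]
  rw [h4]
  change _ = (z * ((-(2 * Real.pi * Complex.I)) ^ k *
        (Real.fourierChar (-(inner ℝ ξ x)) • (psi n R ξ : ℂ)))).re • e
  by_cases hξ : ξ = 0
  · have : psi n R ξ = 0 := psi_zero hR (by rw [hξ, norm_zero]; positivity)
    simp [this]
  · rw [hGe ξ hξ]

lemma op_bound {n k d : ℕ} {V E : Type*} [NormedAddCommGroup V] [InnerProductSpace ℝ V]
    [FiniteDimensional ℝ V]
    [NormedAddCommGroup E] [InnerProductSpace ℝ E] [FiniteDimensional ℝ E]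
    (A : (Fin n → ℕ) → (V →ₗ[ℝ] E)) (b : OrthonormalBasis (Fin d) ℝ V)
    (G : EuclideanSpace ℝ (Fin n) → V) (e : E)
    (hGe : ∀ ξ, ξ ≠ 0 → symb k A ξ (G ξ) = e) {R : ℝ} (hR : 1 ≤ R)
    (H : 𝓢(EuclideanSpace ℝ (Fin n), Fin d → ℂ))
    (hH : ∀ ξ i, H ξ i = ((psi n R ξ * inner ℝ (b i) (G ξ) : ℝ) : ℂ)) (z : ℂ) (hz : ‖z‖ = 1) :
    ∫ x, ‖opApply k A (fun x => Lz b z (𝓕 H x)) x‖ ≤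
      (2 * Real.pi) ^ k * ‖e‖ * ∫ x, ‖𝓕 (fun ξ => (psi n R ξ : ℂ)) x‖ := by
  obtain ⟨P, hP⟩ := ofReal_schwartz (psi n R) (psi_smooth n R) (psi_compact n R (by linarith))
  have hPi : Integrable (fun x => ‖𝓕 (fun ξ => (psi n R ξ : ℂ)) x‖) := by
    have := (𝓕 P).integrable (μ := volume)
    rw [SchwartzMap.fourier_coe, funext hP] at this
    exact this.norm
  rw [← integral_const_mul]
  refine integral_mono_of_nonneg (Filter.Eventually.of_forall fun x => norm_nonneg _)
    (hPi.const_mul _) (Filter.Eventually.of_forall fun x => ?_)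
  simp only
  rw [op_formula A b G e hGe hR H hH z x, norm_smul]
  have h := Complex.abs_re_le_norm
    (z * ((-(2 * Real.pi * Complex.I)) ^ k * 𝓕 (fun ξ => (psi n R ξ : ℂ)) x))
  rw [norm_mul, norm_mul, hz, norm_pow, one_mul] at h
  have h5 : ‖-(2 * (Real.pi : ℂ) * Complex.I)‖ = 2 * Real.pi := by
    simp [abs_of_pos Real.pi_pos]
  rw [h5] at h
  rw [Real.norm_eq_abs]
  calc _ ≤ ((2 * Real.pi) ^ k * ‖𝓕 (fun ξ => (psi n R ξ : ℂ)) x‖) * ‖e‖ := by gcongr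
    _ = _ := by ring

lemma telescoping_term {q s : ℝ} (hq : 2 ≤ q) (hs : 0 ≤ s) :
    s / (1 + s) ^ 2 ≤ q * (q * s / (1 + q * s) - s / (1 + s)) := by
  have hqs : 0 ≤ q * s := mul_nonneg (by linarith) hs
  have h1 : 0 < 1 + q * s := by linarith
  have h2 : 0 < 1 + s := by linarith
  have e : q * (q * s / (1 + q * s) - s / (1 + s)) =
      (q * (q - 1) * s) / ((1 + q * s) * (1 + s)) := by
    field_simp
    ring
  rw [e, div_le_div_iff₀ (by positivity) (by positivity)]
  have h3 : 1 + q * s ≤ q * (q - 1) * (1 + s) := by nlinarith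
  calc s * ((1 + q * s) * (1 + s)) ≤ s * ((q * (q - 1) * (1 + s)) * (1 + s)) := by gcongr
    _ = _ := by ring

lemma sum_bound {n a : ℕ} (ha : 1 ≤ a) (g : 𝓢(EuclideanSpace ℝ (Fin n), ℂ)) :
    ∃ K : ℝ, 0 ≤ K ∧ ∀ (M : ℕ) (x : EuclideanSpace ℝ (Fin n)),
      ‖x‖ ^ a * ∑ j ∈ Finset.range M, ‖(((2 : ℝ) ^ j) ^ a) • g ((2 : ℝ) ^ j • x)‖ ≤ K := by
  obtain ⟨K0, hK0, hK⟩ := schwartz_decay g (2 * a) 0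
  have hq : (2 : ℝ) ≤ 2 ^ a := by
    calc (2 : ℝ) = 2 ^ 1 := by norm_num
      _ ≤ 2 ^ a := pow_le_pow_right₀ (by norm_num) ha
  refine ⟨K0 * 2 ^ a, by positivity, fun M x => ?_⟩
  let s : ℕ → ℝ := fun j => (2 ^ j * ‖x‖) ^ a
  have hs : ∀ j, 0 ≤ s j := fun j => by positivity
  let F : ℕ → ℝ := fun j => s j / (1 + s j)
  have hterm : ∀ j, ‖x‖ ^ a * ‖(((2 : ℝ) ^ j) ^ a) • g ((2 : ℝ) ^ j • x)‖ ≤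
      K0 * 2 ^ a * (F (j + 1) - F j) := by
    intro j
    have h1 : ‖g ((2 : ℝ) ^ j • x)‖ ≤ K0 * ((1 + 2 ^ j * ‖x‖) ^ (2 * a))⁻¹ := by
      have := hK ((2 : ℝ) ^ j • x)
      rwa [norm_iteratedFDeriv_zero, norm_smul, Real.norm_of_nonneg (by positivity)] at this
    have h2 : (1 + s j) ^ 2 ≤ (1 + 2 ^ j * ‖x‖) ^ (2 * a) := by
      rw [mul_comm 2 a, pow_mul]
      gcongr
      have h0 : 0 ≤ 2 ^ j * ‖x‖ := by positivity
      have h5 := pow_add_pow_le (zero_le_one' ℝ) h0 (by omega : a ≠ 0)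
      rwa [one_pow] at h5
    have h3 : s (j + 1) = 2 ^ a * s j := by
      simp only [s]
      rw [pow_succ, ← mul_pow]
      congr 1
      ring
    calc ‖x‖ ^ a * ‖(((2 : ℝ) ^ j) ^ a) • g ((2 : ℝ) ^ j • x)‖
        = s j * ‖g ((2 : ℝ) ^ j • x)‖ := by
          rw [norm_smul, Real.norm_of_nonneg (by positivity), ← mul_assoc, mul_comm (‖x‖ ^ a),
            ← mul_pow]
      _ ≤ s j * (K0 * ((1 + 2 ^ j * ‖x‖) ^ (2 * a))⁻¹) := by gcongr
      _ ≤ s j * (K0 * ((1 + s j) ^ 2)⁻¹) := by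
          have := hs j
          gcongr
      _ = K0 * (s j / (1 + s j) ^ 2) := by ring
      _ ≤ K0 * (2 ^ a * (2 ^ a * s j / (1 + 2 ^ a * s j) - s j / (1 + s j))) := by
          gcongr
          exact telescoping_term hq (hs j)
      _ = _ := by simp only [F, h3]; ring
  rw [Finset.mul_sum]
  refine (Finset.sum_le_sum fun j _ => hterm j).trans ?_
  rw [← Finset.mul_sum, Finset.sum_range_sub]
  have hF0 : 0 ≤ F 0 := div_nonneg (hs 0) (by linarith [hs 0])
  have hF1 : F M ≤ 1 := by
    have := hs M
    exact (div_le_one (by linarith)).2 (by linarith)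
  have : K0 * 2 ^ a * (F M - F 0) ≤ K0 * 2 ^ a * 1 := by
    gcongr
    linarith
  linarith

lemma pair_bound {n a : ℕ} (hn : 1 ≤ n) (ha : 1 ≤ a) (g : 𝓢(EuclideanSpace ℝ (Fin n), ℂ)) :
    ∃ K : ℝ, 0 ≤ K ∧ ∀ (M : ℕ) (F : EuclideanSpace ℝ (Fin n) → ℂ) (c0 : ℂ), Continuous F →
      Integrable (fun x => ‖F x‖ / ‖x‖ ^ a) →
      (∀ j < M, ∫ x, F x * ((((2 : ℝ) ^ j) ^ a) • g ((2 : ℝ) ^ j • x)) = c0) →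
      M * ‖c0‖ ≤ K * ∫ x, ‖F x‖ / ‖x‖ ^ a := by
  have : Nontrivial (EuclideanSpace ℝ (Fin n)) := by
    have : Nonempty (Fin n) := ⟨⟨0, by omega⟩⟩
    infer_instance
  obtain ⟨K, hK0, hK⟩ := sum_bound ha g
  refine ⟨K, hK0, fun M F c0 hF hFi hj => ?_⟩
  have hae : ∀ᵐ x : EuclideanSpace ℝ (Fin n), x ≠ 0 := by
    have : (volume : Measure (EuclideanSpace ℝ (Fin n))) {0} = 0 := measure_singleton 0
    exact compl_mem_ae_iff.2 this
  have hb : ∀ (M : ℕ) (x : EuclideanSpace ℝ (Fin n)), x ≠ 0 →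
      ∑ j ∈ Finset.range M, ‖F x * ((((2 : ℝ) ^ j) ^ a) • g ((2 : ℝ) ^ j • x))‖ ≤
        K * (‖F x‖ / ‖x‖ ^ a) := by
    intro M x hx
    have hx' : 0 < ‖x‖ ^ a := by have := norm_pos_iff.2 hx; positivity
    simp_rw [norm_mul]
    rw [← Finset.mul_sum, ← mul_div_assoc, le_div_iff₀ hx']
    have := mul_le_mul_of_nonneg_left (hK M x) (norm_nonneg (F x))
    linarith
  have hint : ∀ j, Integrable (fun x => F x * ((((2 : ℝ) ^ j) ^ a) • g ((2 : ℝ) ^ j • x))) := by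
    intro j
    refine (hFi.const_mul K).mono' ?_ ?_
    · have : Continuous fun x => g ((2 : ℝ) ^ j • x) := g.continuous.comp (continuous_const_smul _)
      exact (hF.mul (this.const_smul (((2 : ℝ) ^ j) ^ a))).aestronglyMeasurable
    · filter_upwards [hae] with x hx
      refine le_trans ?_ (hb (j + 1) x hx)
      exact Finset.single_le_sum
        (f := fun j => ‖F x * ((((2 : ℝ) ^ j) ^ a) • g ((2 : ℝ) ^ j • x))‖)
        (fun i _ => norm_nonneg _) (Finset.mem_range.2 (Nat.lt_succ_self j))
  have hsum : ∫ x, ∑ j ∈ Finset.range M, F x * ((((2 : ℝ) ^ j) ^ a) • g ((2 : ℝ) ^ j • x)) =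
      M * c0 := by
    rw [integral_finsetSum _ fun j _ => hint j,
      Finset.sum_congr rfl fun j hj' => hj j (Finset.mem_range.1 hj')]
    simp
  have hM : (M : ℝ) * ‖c0‖ = ‖(M : ℂ) * c0‖ := by simp
  rw [hM, ← hsum, ← integral_const_mul]
  refine norm_integral_le_of_norm_le (hFi.const_mul K) ?_
  filter_upwards [hae] with x hx
  exact (norm_sum_le _ _).trans (hb M x hx)

lemma pairing {n : ℕ} (h : EuclideanSpace ℝ (Fin n) → ℝ) (hs : ContDiff ℝ (⊤ : ℕ∞) h)
    (hc : HasCompactSupport h) (g : 𝓢(EuclideanSpace ℝ (Fin n), ℂ)) (r : ℝ) (hr : 0 < r) :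
    ∫ x, 𝓕 (fun ξ => (h ξ : ℂ)) x * g (r • x) = ∫ ξ, (h (r • ξ) : ℂ) * 𝓕 g ξ := by
  obtain ⟨P, hP⟩ := ofReal_schwartz (fun ξ => h (r • ξ)) (hs.comp (contDiff_const_smul r))
    (hc.comp_smul hr.ne')
  have h1 := Measure.integral_comp_smul_of_nonneg (volume : Measure (EuclideanSpace ℝ (Fin n)))
    (fun y => 𝓕 (fun ξ => (h ξ : ℂ)) (r⁻¹ • y) * g y) r (hR := hr.le)
  simp only [smul_smul, inv_mul_cancel₀ hr.ne', one_smul, finrank_euclideanSpace_fin] at h1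
  rw [h1, ← integral_smul]
  have h2 := SchwartzMap.integral_fourier_mul_eq P g
  rw [SchwartzMap.fourier_coe, funext hP] at h2
  rw [← h2]
  congr 1
  ext y
  rw [fourier_scale (fun ξ => (h ξ : ℂ)) r hr y, smul_mul_assoc]

lemma component_formula {n d ℓ : ℕ} {V : Type*} [NormedAddCommGroup V] [InnerProductSpace ℝ V]
    (b : OrthonormalBasis (Fin d) ℝ V)
    (G : EuclideanSpace ℝ (Fin n) → V) {R : ℝ}
    (H : 𝓢(EuclideanSpace ℝ (Fin n), Fin d → ℂ))
    (hH : ∀ ξ i, H ξ i = ((psi n R ξ * inner ℝ (b i) (G ξ) : ℝ) : ℂ)) (i0 : Fin n) (i : Fin d)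
    (x : EuclideanSpace ℝ (Fin n)) :
    iteratedFDeriv ℝ ℓ (⇑(𝓕 H : 𝓢(EuclideanSpace ℝ (Fin n), Fin d → ℂ))) x
      (fun _ => EuclideanSpace.single i0 1) i =
    (-(2 * Real.pi * Complex.I)) ^ ℓ *
      𝓕 (fun ξ => ((psi n R ξ * (ξ i0 ^ ℓ * inner ℝ (b i) (G ξ)) : ℝ) : ℂ)) x := by
  obtain ⟨h1, h2⟩ := iter_fourier H ℓ x (fun _ => EuclideanSpace.single i0 1)
  rw [← SchwartzMap.fourier_coe] at h2
  rw [h2, Real.fourier_eq, ← integral_const_mul]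
  have h3 := (ContinuousLinearMap.proj (R := ℝ) (φ := fun _ : Fin d => ℂ) i).integral_comp_comm h1
  refine h3.symm.trans ?_
  congr 1
  ext ξ
  simp only [ContinuousLinearMap.proj_apply, Pi.smul_apply, hH, Circle.smul_def, smul_eq_mul,
    Complex.real_smul, Finset.prod_const, Finset.card_univ, Fintype.card_fin,
    EuclideanSpace.inner_single_right]
  simp
  ring

lemma component_bound {n d ℓ : ℕ} {V : Type*} [NormedAddCommGroup V] [InnerProductSpace ℝ V]
    (b : OrthonormalBasis (Fin d) ℝ V)
    (G : EuclideanSpace ℝ (Fin n) → V) {R : ℝ}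
    (H : 𝓢(EuclideanSpace ℝ (Fin n), Fin d → ℂ))
    (hH : ∀ ξ i, H ξ i = ((psi n R ξ * inner ℝ (b i) (G ξ) : ℝ) : ℂ)) (i0 : Fin n) (i : Fin d)
    (x : EuclideanSpace ℝ (Fin n)) :
    ‖𝓕 (fun ξ => ((psi n R ξ * (ξ i0 ^ ℓ * inner ℝ (b i) (G ξ)) : ℝ) : ℂ)) x‖ ≤
      ‖iteratedFDeriv ℝ ℓ (fun x => Lz b 1 (𝓕 H x)) x‖ +
      ‖iteratedFDeriv ℝ ℓ (fun x => Lz b (-Complex.I) (𝓕 H x)) x‖ := by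
  have hUs : ContDiff ℝ (⊤ : ℕ∞) (⇑(𝓕 H : 𝓢(EuclideanSpace ℝ (Fin n), Fin d → ℂ))) :=
    (𝓕 H).smooth _
  set y := iteratedFDeriv ℝ ℓ (⇑(𝓕 H : 𝓢(EuclideanSpace ℝ (Fin n), Fin d → ℂ))) x
      (fun _ => EuclideanSpace.single i0 1) with hy
  have hz : ∀ z : ℂ, |(z * y i).re| ≤ ‖iteratedFDeriv ℝ ℓ (fun x => Lz b z (𝓕 H x)) x‖ := by
    intro z
    refine (Lz_norm b z y i).trans ?_
    have h := (Lz b z).iteratedFDeriv_comp_left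
      (f := ⇑(𝓕 H : 𝓢(EuclideanSpace ℝ (Fin n), Fin d → ℂ))) (x := x) (n := (⊤ : ℕ∞))
      hUs.contDiffAt (i := ℓ) (by exact_mod_cast le_top)
    have h' : iteratedFDeriv ℝ ℓ (fun x => Lz b z (𝓕 H x)) x
        (fun _ => EuclideanSpace.single i0 1) = Lz b z y :=
      congrArg (fun T => T (fun _ => EuclideanSpace.single i0 1)) h
    rw [← h']
    refine (ContinuousMultilinearMap.le_opNorm _ _).trans ?_
    simp
  have hc := component_formula (ℓ := ℓ) b G H hH i0 i x
  rw [← hy] at hc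
  have h1 := hz 1
  have h2 := hz (-Complex.I)
  have e1 : (1 * y i).re = (y i).re := by rw [one_mul]
  have e2 : (-Complex.I * y i).re = (y i).im := by simp
  rw [e1] at h1
  rw [e2] at h2
  have h3 := Complex.norm_le_abs_re_add_abs_im (y i)
  have h4 : ‖𝓕 (fun ξ => ((psi n R ξ * (ξ i0 ^ ℓ * inner ℝ (b i) (G ξ)) : ℝ) : ℂ)) x‖ ≤ ‖y i‖ := by
    rw [hc, norm_mul, norm_pow]
    have h5 : ‖-(2 * (Real.pi : ℂ) * Complex.I)‖ = 2 * Real.pi := by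
      simp [abs_of_pos Real.pi_pos]
    rw [h5]
    refine le_mul_of_one_le_left (norm_nonneg _) (one_le_pow₀ ?_)
    linarith [Real.pi_gt_three]
  linarith

/-- Core contradiction: no nonzero vector lies in all the ranges. -/
lemma core
    {V E : Type*} [NormedAddCommGroup V] [InnerProductSpace ℝ V] [FiniteDimensional ℝ V]
    [NormedAddCommGroup E] [InnerProductSpace ℝ E] [FiniteDimensional ℝ E]
    (n k ℓ a : ℕ) (ha : 1 ≤ a) (hak : a + ℓ = k) (han : a < n)
    (A : (Fin n → ℕ) → (V →ₗ[ℝ] E))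
    (hell : ∀ ξ : EuclideanSpace ℝ (Fin n), ξ ≠ 0 → Function.Injective (symb k A ξ))
    (C : ℝ) (hC : 0 < C) (hest : ∀ u : EuclideanSpace ℝ (Fin n) → V,
      ContDiff ℝ (⊤ : ℕ∞) u → HasCompactSupport u →
      ∫ x, ‖iteratedFDeriv ℝ ℓ u x‖ / ‖x‖ ^ a ≤ C * ∫ x, ‖opApply k A u x‖)
    (e : E) (he : ∀ ξ : EuclideanSpace ℝ (Fin n), ξ ≠ 0 → e ∈ LinearMap.range (symb k A ξ)) :
    e = 0 := by
  by_contra he0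
  obtain ⟨G, hGs, hGe, hGh⟩ := exists_G A hell e he
  let b := stdOrthonormalBasis ℝ V
  let i0 : Fin n := ⟨0, by omega⟩
  let ξ0 : EuclideanSpace ℝ (Fin n) := EuclideanSpace.single i0 1
  have hξ0n : ‖ξ0‖ = 1 := by simp [ξ0]
  have hξ0 : ξ0 ≠ 0 := by rw [← norm_ne_zero_iff, hξ0n]; exact one_ne_zero
  have hG0 : G ξ0 ≠ 0 := by
    intro h
    apply he0
    rw [← hGe ξ0 hξ0, h, map_zero]
  obtain ⟨i, hi⟩ : ∃ i, inner ℝ (b i) (G ξ0) ≠ 0 := by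
    by_contra! h
    apply hG0
    rw [← b.sum_repr' (G ξ0)]
    exact Finset.sum_eq_zero fun i _ => by rw [h i, zero_smul]
  let q : EuclideanSpace ℝ (Fin n) → ℝ := fun ξ => ξ i0 ^ ℓ * inner ℝ (b i) (G ξ)
  have hqs : ∀ ξ, ξ ≠ 0 → ContDiffAt ℝ (⊤ : ℕ∞) q ξ := by
    intro ξ hξ
    refine ContDiffAt.mul (ContDiffAt.pow ?_ _) (contDiffAt_const.inner ℝ (hGs ξ hξ))
    exact (by fun_prop : ContDiff ℝ (⊤ : ℕ∞) fun ξ : EuclideanSpace ℝ (Fin n) => ξ i0).contDiffAt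
  have hqh : ∀ ξ, ξ ≠ 0 → ∀ r : ℝ, r ≠ 0 → r ^ a * q (r • ξ) = q ξ := by
    intro ξ hξ r hr
    simp only [q]
    rw [← hGh ξ hξ r hr, inner_smul_right, ← hak, PiLp.smul_apply, smul_eq_mul, mul_pow, pow_add]
    ring
  have hq0 : q ξ0 ≠ 0 := by
    simp only [q]
    refine mul_ne_zero (pow_ne_zero _ ?_) hi
    simp [ξ0]
  let φ0 : ContDiffBump ξ0 := ⟨1 / 4, 1 / 2, by norm_num, by norm_num⟩
  have hφ0 : ∀ ξ, φ0 ξ ≠ 0 → 1 / 2 ≤ ‖ξ‖ ∧ ‖ξ‖ ≤ 3 / 2 := by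
    intro ξ h
    have hd : dist ξ ξ0 < 1 / 2 := by
      by_contra! hd
      exact h (φ0.zero_of_le_dist hd)
    rw [dist_eq_norm] at hd
    have h1 := norm_sub_norm_le ξ ξ0
    have h2 := norm_sub_norm_le ξ0 ξ
    rw [norm_sub_rev ξ0 ξ] at h2
    constructor <;> linarith
  have hφ4 : ∀ ξ, φ0 ξ ≠ 0 → psi n 4 ξ = 1 := by
    intro ξ h
    obtain ⟨h1, h2⟩ := hφ0 ξ h
    exact psi_one (by norm_num) (by linarith) (by linarith)
  have hp4 : ContDiff ℝ (⊤ : ℕ∞) fun ξ => psi n 4 ξ * q ξ := psi_mul_smooth (by norm_num) q hqs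
  let γ : EuclideanSpace ℝ (Fin n) → ℝ := fun ξ => φ0 ξ * (psi n 4 ξ * q ξ)
  have hγs : ContDiff ℝ (⊤ : ℕ∞) γ := φ0.contDiff.mul hp4
  have hγc : HasCompactSupport γ := φ0.hasCompactSupport.mul_right
  obtain ⟨Γ, hΓ⟩ := ofReal_schwartz γ hγs hγc
  let g : 𝓢(EuclideanSpace ℝ (Fin n), ℂ) := 𝓕⁻ Γ
  have hg : 𝓕 g = Γ := FourierTransform.fourier_fourierInv_eq Γ
  let c0 : ℝ := ∫ ξ, φ0 ξ * (psi n 4 ξ * q ξ) ^ 2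
  have hc0 : 0 < c0 := by
    refine Continuous.integral_pos_of_hasCompactSupport_nonneg_nonzero (x := ξ0)
      (φ0.continuous.mul (hp4.continuous.pow 2)) φ0.hasCompactSupport.mul_right
      (fun ξ => mul_nonneg φ0.nonneg (sq_nonneg _)) ?_
    have h1 : φ0 ξ0 = 1 := φ0.eventuallyEq_one.eq_of_nhds
    rw [h1, hφ4 ξ0 (by rw [h1]; exact one_ne_zero), one_mul, one_mul]
    exact pow_ne_zero _ hq0
  obtain ⟨K, hK0, hK⟩ := pair_bound (n := n) (by omega) ha g
  obtain ⟨B, hB0, hB⟩ := psi_fourier n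
  have key : ∀ M : ℕ, M * c0 ≤ K * (2 * (C * ((2 * Real.pi) ^ k * ‖e‖ * B))) := by
    intro M
    let R : ℝ := 2 ^ (M + 2)
    have hR : 1 ≤ R := one_le_pow₀ (by norm_num)
    obtain ⟨H, hH⟩ := exists_H b G hGs hR
    let h : EuclideanSpace ℝ (Fin n) → ℝ := fun ξ => psi n R ξ * q ξ
    have hhs : ContDiff ℝ (⊤ : ℕ∞) h := psi_mul_smooth hR q hqs
    have hhc : HasCompactSupport h := psi_mul_compact hR q
    obtain ⟨P, hP⟩ := ofReal_schwartz h hhs hhc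
    have hPF : (⇑(𝓕 P : 𝓢(EuclideanSpace ℝ (Fin n), ℂ))) = 𝓕 (fun ξ => (h ξ : ℂ)) := by
      rw [SchwartzMap.fourier_coe, funext hP]
    have hFc : Continuous (𝓕 (fun ξ => (h ξ : ℂ))) := by
      rw [← hPF]; exact (𝓕 P).continuous
    have hFi : Integrable (fun x => ‖𝓕 (fun ξ => (h ξ : ℂ)) x‖ / ‖x‖ ^ a) := by
      have := hardy_integrable 0 a han (𝓕 P : 𝓢(EuclideanSpace ℝ (Fin n), ℂ))
      simp only [norm_iteratedFDeriv_zero] at this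
      rwa [hPF] at this
    have hpair : ∀ j < M, ∫ x, 𝓕 (fun ξ => (h ξ : ℂ)) x *
        ((((2 : ℝ) ^ j) ^ a) • g ((2 : ℝ) ^ j • x)) = (c0 : ℂ) := by
      intro j hj
      have hr : (0 : ℝ) < 2 ^ j := by positivity
      simp_rw [mul_smul_comm]
      rw [integral_smul, pairing h hhs hhc g _ hr, hg, ← integral_smul]
      have : (c0 : ℂ) = ∫ ξ, ((φ0 ξ * (psi n 4 ξ * q ξ) ^ 2 : ℝ) : ℂ) := integral_ofReal.symm
      rw [this]
      congr 1
      ext ξ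
      rw [hΓ, Complex.real_smul, ← Complex.ofReal_mul, ← Complex.ofReal_mul]
      congr 1
      by_cases hφ : φ0 ξ = 0
      · simp [γ, hφ]
      · obtain ⟨h1, h2⟩ := hφ0 ξ hφ
        have hξ : ξ ≠ 0 := by rw [← norm_pos_iff]; linarith
        have hjR : (2 : ℝ) ^ j * 4 ≤ R := by
          have : (2 : ℝ) ^ j * 4 = 2 ^ (j + 2) := by rw [pow_add]; norm_num
          rw [this]
          exact pow_le_pow_right₀ (by norm_num) (by omega)
        have hj1 : (1 : ℝ) ≤ 2 ^ j := one_le_pow₀ (by norm_num)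
        have hn : ‖(2 : ℝ) ^ j • ξ‖ = 2 ^ j * ‖ξ‖ := by
          rw [norm_smul, Real.norm_of_nonneg hr.le]
        have hR4 : 4 ≤ R := by linarith
        have hψ : psi n R ((2 : ℝ) ^ j • ξ) = 1 := by
          refine psi_one hR ?_ ?_
          · rw [hn]
            calc (2 : ℝ) = 4 * (1 * (1 / 2)) := by norm_num
              _ ≤ R * (2 ^ j * ‖ξ‖) := by gcongr
          · rw [hn]
            calc (2 : ℝ) ^ j * ‖ξ‖ ≤ 2 ^ j * 4 := by gcongr; linarith
              _ ≤ R := hjR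
        have hq' := hqh ξ hξ _ hr.ne'
        simp only [h, γ, hψ, hφ4 ξ hφ, one_mul]
        rw [← mul_assoc, hq']
        ring
    have h1 := hK M _ (c0 : ℂ) hFc hFi hpair
    rw [Complex.norm_real, Real.norm_of_nonneg hc0.le] at h1
    refine h1.trans ?_
    gcongr
    let u : ℂ → 𝓢(EuclideanSpace ℝ (Fin n), V) := fun z => (𝓕 H).postcompCLM (Lz b z)
    have hu : ∀ z, (u z : EuclideanSpace ℝ (Fin n) → V) = fun x => Lz b z (𝓕 H x) :=
      fun z => rfl
    have hui : ∀ z, Integrable (fun x => ‖iteratedFDeriv ℝ ℓ (u z) x‖ / ‖x‖ ^ a) :=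
      fun z => hardy_integrable ℓ a han (u z)
    have hub : ∀ z : ℂ, ‖z‖ = 1 → ∫ x, ‖iteratedFDeriv ℝ ℓ (u z) x‖ / ‖x‖ ^ a ≤
        C * ((2 * Real.pi) ^ k * ‖e‖ * B) := by
      intro z hz
      refine (hardy_schwartz a han A C hest (u z)).trans ?_
      gcongr
      rw [hu]
      refine (op_bound A b G e hGe hR H hH z hz).trans ?_
      gcongr
      exact hB R (by linarith)
    have h2 : ∫ x, ‖𝓕 (fun ξ => (h ξ : ℂ)) x‖ / ‖x‖ ^ a ≤
        ∫ x, (‖iteratedFDeriv ℝ ℓ (u 1) x‖ / ‖x‖ ^ a +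
          ‖iteratedFDeriv ℝ ℓ (u (-Complex.I)) x‖ / ‖x‖ ^ a) := by
      refine integral_mono hFi ((hui _).add (hui _)) fun x => ?_
      simp only
      rw [← add_div]
      gcongr
      exact component_bound b G H hH i0 i x
    rw [integral_add (hui _) (hui _)] at h2
    have h3 := hub 1 (by simp)
    have h4 := hub (-Complex.I) (by simp)
    linarith
  obtain ⟨M, hM⟩ := exists_nat_gt (K * (2 * (C * ((2 * Real.pi) ^ k * ‖e‖ * B))) / c0)
  rw [div_lt_iff₀ hc0] at hM
  exact absurd (key M) (not_le.2 hM)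

/-- Necessity of cancellation for the Hardy inequality: if `A(D)` is injectively
elliptic and the Hardy inequality holds, then `A(D)` is cancelling. -/
theorem stmt19
    {V E : Type*} [NormedAddCommGroup V] [InnerProductSpace ℝ V] [FiniteDimensional ℝ V]
    [NormedAddCommGroup E] [InnerProductSpace ℝ E] [FiniteDimensional ℝ E]
    (n k ℓ : ℕ) (hn : 2 ≤ n) (hk : 1 ≤ k) (hl : ℓ < k) (hkl : k - ℓ < n)
    (A : (Fin n → ℕ) → (V →ₗ[ℝ] E))
    (hell : ∀ ξ : EuclideanSpace ℝ (Fin n), ξ ≠ 0 → Function.Injective (symb k A ξ))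
    (hest : ∃ C : ℝ, 0 < C ∧ ∀ u : EuclideanSpace ℝ (Fin n) → V,
      ContDiff ℝ (⊤ : ℕ∞) u → HasCompactSupport u →
      ∫ x, ‖iteratedFDeriv ℝ ℓ u x‖ / ‖x‖ ^ (k - ℓ)
        ≤ C * ∫ x, ‖opApply k A u x‖) :
    (⋂ ξ ∈ {ξ : EuclideanSpace ℝ (Fin n) | ξ ≠ 0},
        (LinearMap.range (symb k A ξ) : Set E)) = {0} := by
  obtain ⟨C, hC, hest⟩ := hest
  apply Set.Subset.antisymm
  · intro e he
    simp only [Set.mem_iInter, Set.mem_setOf_eq, SetLike.mem_coe] at he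
    exact core n k ℓ (k - ℓ) (by omega) (by omega) hkl A hell C hC hest e he
  · intro e he
    rw [Set.mem_singleton_iff] at he
    subst he
    simp

end
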